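/- arXiv:2512.01689 — 2 statements merged into one kernel-verified Lean document; each statement's English description precedes it below -/
import Mathlib

section
/- Let σ > σ' > 0, β, β', κ ∈ ℝ. Define f : ℝ × ℤ/2ℤ → ℂ by f(s,0) = exp(−σs² + iβs) and f(s,1) = κ·exp(−σ's² + iβ's). Then f is the characteristic function of a probability measure on ℝ × ℤ/2ℤ if and only if 0 < |κ| ≤ √(σ'/σ)·exp(−(β−β')²/(4(σ−σ'))) (or κ = 0, in which case f is also a characteristic function). -/
open MeasureTheory

/-- The pairing `((t,k),(s,l)) = e^{ist}·(−1)^{kl}` between `ℝ × ℤ/2ℤ` and its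
character group (identified with `ℝ × ℤ/2ℤ`). -/
noncomputable def pairing (x y : ℝ × ZMod 2) : ℂ :=
  Complex.exp ((y.1 : ℂ) * (x.1 : ℂ) * Complex.I) * (-1 : ℂ) ^ (x.2 * y.2).val

/-- The characteristic function of a measure on `ℝ × ℤ/2ℤ`. -/
noncomputable def charFun2 (μ : Measure (ℝ × ZMod 2)) (y : ℝ × ZMod 2) : ℂ :=
  ∫ x, pairing x y ∂μ

open ProbabilityTheory
open scoped NNReal ENNReal

/-- The density of a Gaussian relative to a Gaussian of smaller variance. -/
lemma gaussianPDFReal_eq_mul_gaussianPDFReal (m m' : ℝ) {v v' : ℝ≥0} (hv' : 0 < v') (hv : v' < v)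
    (x : ℝ) :
    gaussianPDFReal m v x =
      Real.sqrt (v' / v) * Real.exp (-(m - m') ^ 2 / (2 * (v - v'))) *
        Real.exp ((v - v') / (2 * v * v') * (x - (v * m' - v' * m) / (v - v')) ^ 2) *
        gaussianPDFReal m' v' x := by
  have h1 : (0 : ℝ) < v' := by exact_mod_cast hv'
  have h2 : (v' : ℝ) < v := by exact_mod_cast hv
  have h3 : (0 : ℝ) < v := h1.trans h2
  have h4 : (v : ℝ) - v' ≠ 0 := (sub_pos.2 h2).ne'
  have hexp : Real.exp (-(x - m) ^ 2 / (2 * v)) =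
      Real.exp (-(m - m') ^ 2 / (2 * (v - v'))) *
        Real.exp ((v - v') / (2 * v * v') * (x - (v * m' - v' * m) / (v - v')) ^ 2) *
        Real.exp (-(x - m') ^ 2 / (2 * v')) := by
    rw [← Real.exp_add, ← Real.exp_add]
    congr 1
    field_simp
    ring
  have hsqrt : (Real.sqrt (2 * Real.pi * v))⁻¹ =
      Real.sqrt (v' / v) * (Real.sqrt (2 * Real.pi * v'))⁻¹ := by
    rw [← Real.sqrt_inv, ← Real.sqrt_inv, ← Real.sqrt_mul (by positivity)]
    congr 1
    field_simp
  rw [gaussianPDFReal, gaussianPDFReal, hexp, hsqrt]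
  ring

lemma forall_mul_gaussianPDFReal_le_iff (m m' c : ℝ) {v v' : ℝ≥0} (hv' : 0 < v') (hv : v' < v) :
    (∀ x, c * gaussianPDFReal m' v' x ≤ gaussianPDFReal m v x) ↔
      c ≤ Real.sqrt (v' / v) * Real.exp (-(m - m') ^ 2 / (2 * (v - v'))) := by
  constructor
  · intro h
    have hx := h ((v * m' - v' * m) / (v - v'))
    rw [gaussianPDFReal_eq_mul_gaussianPDFReal m m' hv' hv] at hx
    simpa using le_of_mul_le_mul_right hx (gaussianPDFReal_pos _ _ _ hv'.ne')
  · intro h x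
    rw [gaussianPDFReal_eq_mul_gaussianPDFReal m m' hv' hv]
    gcongr
    · exact gaussianPDFReal_nonneg _ _ _
    · refine h.trans (le_mul_of_one_le_right (by positivity) (Real.one_le_exp ?_))
      have h2 : (0 : ℝ) ≤ v - v' := sub_nonneg.2 (by exact_mod_cast hv.le)
      positivity

lemma continuous_gaussianPDFReal (m : ℝ) (v : ℝ≥0) : Continuous (gaussianPDFReal m v) := by
  rw [gaussianPDFReal_def]
  fun_prop

/-- A multiple of a Gaussian measure is dominated by another Gaussian measure if and only if the
densities are dominated pointwise. -/
lemma ofReal_smul_gaussianReal_le_iff (m m' : ℝ) {c : ℝ} (hc : 0 ≤ c) {v v' : ℝ≥0}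
    (hv' : v' ≠ 0) (hv : v ≠ 0) :
    ENNReal.ofReal c • gaussianReal m' v' ≤ gaussianReal m v ↔
      ∀ x, c * gaussianPDFReal m' v' x ≤ gaussianPDFReal m v x := by
  have key : ∀ x, (ENNReal.ofReal c • gaussianPDF m' v') x ≤ gaussianPDF m v x ↔
      c * gaussianPDFReal m' v' x ≤ gaussianPDFReal m v x := fun x ↦ by
    rw [Pi.smul_apply, smul_eq_mul, gaussianPDF, gaussianPDF, ← ENNReal.ofReal_mul hc,
      ENNReal.ofReal_le_ofReal_iff (gaussianPDFReal_nonneg _ _ _)]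
  rw [gaussianReal_of_var_ne_zero _ hv', gaussianReal_of_var_ne_zero _ hv,
    ← withDensity_smul _ (measurable_gaussianPDF _ _)]
  constructor
  · intro h
    have hae : ENNReal.ofReal c • gaussianPDF m' v' ≤ᵐ[volume] gaussianPDF m v := by
      refine ae_le_of_forall_setLIntegral_le_of_sigmaFinite
        ((measurable_gaussianPDF _ _).const_smul _) fun s hs _ ↦ ?_
      rw [← withDensity_apply _ hs, ← withDensity_apply _ hs]
      exact h s
    have hopen : IsOpen {x | gaussianPDFReal m v x < c * gaussianPDFReal m' v' x} :=
      isOpen_lt (continuous_gaussianPDFReal _ _)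
        (continuous_const.mul (continuous_gaussianPDFReal _ _))
    have hnull : volume {x | gaussianPDFReal m v x < c * gaussianPDFReal m' v' x} = 0 := by
      have : ∀ᵐ x, c * gaussianPDFReal m' v' x ≤ gaussianPDFReal m v x :=
        hae.mono fun x hx ↦ (key x).1 hx
      simpa [ae_iff] using this
    have hempty := (hopen.measure_eq_zero_iff volume).1 hnull
    intro x
    by_contra! hx
    exact hempty.subset hx
  · intro h
    exact withDensity_mono (Filter.Eventually.of_forall fun x ↦ (key x).2 (h x))

lemma norm_pairing (x y : ℝ × ZMod 2) : ‖pairing x y‖ = 1 := by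
  rw [pairing, ← Complex.ofReal_mul, norm_mul, Complex.norm_exp_ofReal_mul_I, norm_pow, norm_neg,
    norm_one, one_pow, one_mul]

lemma measurable_pairing_left (y : ℝ × ZMod 2) : Measurable fun x ↦ pairing x y := by
  unfold pairing
  refine Measurable.mul (by fun_prop) ?_
  exact (measurable_of_countable fun k : ZMod 2 ↦ (-1 : ℂ) ^ (k * y.2).val).comp measurable_snd

lemma integrable_pairing (μ : Measure (ℝ × ZMod 2)) [IsFiniteMeasure μ] (y : ℝ × ZMod 2) :
    Integrable (fun x ↦ pairing x y) μ :=
  .of_bound (measurable_pairing_left y).aestronglyMeasurable 1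
    (Filter.Eventually.of_forall fun x ↦ (norm_pairing x y).le)

lemma charFun2_add (μ ν : Measure (ℝ × ZMod 2)) [IsFiniteMeasure μ] [IsFiniteMeasure ν]
    (y : ℝ × ZMod 2) : charFun2 (μ + ν) y = charFun2 μ y + charFun2 ν y :=
  integral_add_measure (integrable_pairing μ y) (integrable_pairing ν y)

lemma charFun2_map_prodMk (ν : Measure ℝ) (k : ZMod 2) (y : ℝ × ZMod 2) :
    charFun2 (ν.map (·, k)) y = (-1) ^ (k * y.2).val * charFun ν y.1 := by
  rw [charFun2, integral_map (by fun_prop) (measurable_pairing_left y).aestronglyMeasurable,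
    charFun_apply_real, mul_comm, ← integral_mul_const]
  rfl

lemma charFun2_sum_map_prodMk (ν₀ ν₁ : Measure ℝ) [IsFiniteMeasure ν₀] [IsFiniteMeasure ν₁]
    (s : ℝ) :
    charFun2 (ν₀.map (·, 0) + ν₁.map (·, 1)) (s, 0) = charFun ν₀ s + charFun ν₁ s ∧
      charFun2 (ν₀.map (·, 0) + ν₁.map (·, 1)) (s, 1) = charFun ν₀ s - charFun ν₁ s := by
  have h1 : (1 : ZMod 2).val = 1 := rfl
  constructor <;> rw [charFun2_add, charFun2_map_prodMk, charFun2_map_prodMk] <;>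
    simp [h1, sub_eq_add_neg]

lemma exists_eq_map_prodMk_add (μ : Measure (ℝ × ZMod 2)) [IsFiniteMeasure μ] :
    ∃ ν₀ ν₁ : Measure ℝ, IsFiniteMeasure ν₀ ∧ IsFiniteMeasure ν₁ ∧
      μ = ν₀.map (·, 0) + ν₁.map (·, 1) := by
  have hS : MeasurableSet (Prod.snd ⁻¹' {0} : Set (ℝ × ZMod 2)) :=
    measurable_snd (measurableSet_singleton _)
  have key : ∀ (T : Set (ℝ × ZMod 2)) (k : ZMod 2), MeasurableSet T → (∀ x ∈ T, x.2 = k) →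
      ((μ.restrict T).map Prod.fst).map (·, k) = μ.restrict T := fun T k hT h ↦ by
    rw [Measure.map_map (by fun_prop) measurable_fst]
    conv_rhs => rw [← Measure.map_id (μ := μ.restrict T)]
    refine Measure.map_congr ((ae_restrict_iff' hT).2 (Filter.Eventually.of_forall fun x hx ↦ ?_))
    exact Prod.ext rfl (h x hx).symm
  refine ⟨(μ.restrict (Prod.snd ⁻¹' {0})).map Prod.fst,
    (μ.restrict (Prod.snd ⁻¹' {0})ᶜ).map Prod.fst, inferInstance, inferInstance, ?_⟩
  rw [key _ 0 hS fun x hx ↦ hx, key _ 1 hS.compl, Measure.restrict_add_restrict_compl hS]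
  intro x hx
  have : ∀ k : ZMod 2, k ≠ 0 → k = 1 := by decide
  exact this _ hx

lemma charFun_add_measure (μ ν : Measure ℝ) [IsFiniteMeasure μ] [IsFiniteMeasure ν] (s : ℝ) :
    charFun (μ + ν) s = charFun μ s + charFun ν s := by
  have h : ∀ (ρ : Measure ℝ) [IsFiniteMeasure ρ],
      Integrable (fun x : ℝ ↦ Complex.exp (s * x * Complex.I)) ρ := fun ρ _ ↦
    .of_bound (by fun_prop) 1 (Filter.Eventually.of_forall fun x ↦ by
      rw [← Complex.ofReal_mul, Complex.norm_exp_ofReal_mul_I])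
  simp only [charFun_apply_real]
  exact integral_add_measure (h μ) (h ν)

lemma charFun_ofReal_smul_measure {c : ℝ} (hc : 0 ≤ c) (μ : Measure ℝ) (s : ℝ) :
    charFun (ENNReal.ofReal c • μ) s = c * charFun μ s := by
  simp [charFun_apply_real, integral_smul_measure, ENNReal.toReal_ofReal hc]

/-- A pair consisting of the characteristic function of `N` and `κ` times that of `N'` is a
characteristic function on `ℝ × ℤ/2ℤ` if and only if `|κ| N' ≤ N`. -/
lemma exists_charFun2_eq_iff (N N' : Measure ℝ) [IsProbabilityMeasure N] [IsProbabilityMeasure N']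
    (κ : ℝ) :
    (∃ μ : Measure (ℝ × ZMod 2), IsProbabilityMeasure μ ∧
      (∀ s, charFun2 μ (s, 0) = charFun N s) ∧ (∀ s, charFun2 μ (s, 1) = κ * charFun N' s)) ↔
    ENNReal.ofReal |κ| • N' ≤ N := by
  have : IsFiniteMeasure (ENNReal.ofReal |κ| • N') := Measure.smul_finite _ ENNReal.ofReal_ne_top
  have hsmul := charFun_ofReal_smul_measure (abs_nonneg κ) N'
  constructor
  · rintro ⟨μ, hμ, h0, h1⟩
    obtain ⟨ν₀, ν₁, _, _, rfl⟩ := exists_eq_map_prodMk_add μ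
    simp only [charFun2_sum_map_prodMk] at h0 h1
    have hN : ν₀ + ν₁ = N := Measure.ext_of_charFun <| funext fun s ↦ by
      rw [charFun_add_measure, h0]
    rcases le_total 0 κ with hκ | hκ
    · have h : ENNReal.ofReal |κ| • N' + ν₁ = ν₀ := Measure.ext_of_charFun <| funext fun s ↦ by
        rw [charFun_add_measure, hsmul, abs_of_nonneg hκ, ← h1 s, sub_add_cancel]
      calc _ ≤ ENNReal.ofReal |κ| • N' + ν₁ := Measure.le_add_right le_rfl
        _ = ν₀ := h
        _ ≤ ν₀ + ν₁ := Measure.le_add_right le_rfl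
        _ = N := hN
    · have h : ENNReal.ofReal |κ| • N' + ν₀ = ν₁ := Measure.ext_of_charFun <| funext fun s ↦ by
        rw [charFun_add_measure, hsmul, abs_of_nonpos hκ, Complex.ofReal_neg, neg_mul, ← h1 s,
          neg_sub, sub_add_cancel]
      calc _ ≤ ENNReal.ofReal |κ| • N' + ν₀ := Measure.le_add_right le_rfl
        _ = ν₁ := h
        _ ≤ ν₀ + ν₁ := Measure.le_add_left le_rfl
        _ = N := hN
  · intro h
    have hN := Measure.sub_add_cancel_of_le h
    set ρ := N - ENNReal.ofReal |κ| • N' with hρ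
    have : IsFiniteMeasure ρ := by rw [hρ]; infer_instance
    have hρs : ∀ s, charFun ρ s + |κ| * charFun N' s = charFun N s := fun s ↦ by
      rw [← hsmul, ← charFun_add_measure, hN]
    have hhalf := charFun_ofReal_smul_measure (c := 1 / 2) (by norm_num) ρ
    set τ := ENNReal.ofReal (1 / 2) • ρ with hτ
    have : IsFiniteMeasure τ := Measure.smul_finite _ ENNReal.ofReal_ne_top
    suffices h : ∃ ν₀ ν₁ : Measure ℝ, IsFiniteMeasure ν₀ ∧ IsFiniteMeasure ν₁ ∧
        (∀ s, charFun ν₀ s + charFun ν₁ s = charFun N s) ∧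
        ∀ s, charFun ν₀ s - charFun ν₁ s = κ * charFun N' s by
      obtain ⟨ν₀, ν₁, _, _, h0, h1⟩ := h
      refine ⟨ν₀.map (·, 0) + ν₁.map (·, 1), ⟨?_⟩, ?_, ?_⟩
      · have hsum : ν₀ + ν₁ = N := Measure.ext_of_charFun <| funext fun s ↦ by
          rw [charFun_add_measure, h0]
        rw [Measure.add_apply, Measure.map_apply (by fun_prop) .univ,
          Measure.map_apply (by fun_prop) .univ, Set.preimage_univ, Set.preimage_univ,
          ← Measure.add_apply, hsum, measure_univ]
      · simpa only [charFun2_sum_map_prodMk] using h0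
      · simpa only [charFun2_sum_map_prodMk] using h1
    rcases le_total 0 κ with hκ | hκ
    · refine ⟨τ + ENNReal.ofReal |κ| • N', τ, inferInstance, inferInstance,
        fun s ↦ ?_, fun s ↦ ?_⟩
      · rw [charFun_add_measure, hhalf, hsmul, ← hρs]
        push_cast
        ring
      · rw [charFun_add_measure, hsmul, abs_of_nonneg hκ]
        ring
    · refine ⟨τ, τ + ENNReal.ofReal |κ| • N', inferInstance, inferInstance,
        fun s ↦ ?_, fun s ↦ ?_⟩
      · rw [charFun_add_measure, hhalf, hsmul, ← hρs]
        push_cast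
        ring
      · rw [charFun_add_measure, hsmul, abs_of_nonpos hκ]
        push_cast
        ring

theorem stmt_2 (σ σ' β β' κ : ℝ) (hσ' : 0 < σ') (hσ : σ' < σ) :
    (∃ μ : Measure (ℝ × ZMod 2), IsProbabilityMeasure μ ∧
      (∀ s : ℝ, charFun2 μ (s, 0) =
        Complex.exp (-(σ : ℂ) * s ^ 2 + (β : ℂ) * s * Complex.I)) ∧
      (∀ s : ℝ, charFun2 μ (s, 1) =
        (κ : ℂ) * Complex.exp (-(σ' : ℂ) * s ^ 2 + (β' : ℂ) * s * Complex.I))) ↔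
    (κ = 0 ∨ (0 < |κ| ∧
      |κ| ≤ Real.sqrt (σ' / σ) * Real.exp (-(β - β') ^ 2 / (4 * (σ - σ'))))) := by
  have hgauss : ∀ b t : ℝ, 0 < t → ∀ s : ℝ,
      Complex.exp (-(t : ℂ) * s ^ 2 + (b : ℂ) * s * Complex.I) =
        charFun (gaussianReal b (2 * t).toNNReal) s := fun b t ht s ↦ by
    rw [charFun_gaussianReal, Real.coe_toNNReal _ (by positivity)]
    congr 1
    push_cast
    ring
  have hσ0 : 0 < σ := hσ'.trans hσ
  have hv' : 0 < (2 * σ').toNNReal := Real.toNNReal_pos.2 (by positivity)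
  have hv : (2 * σ').toNNReal < (2 * σ).toNNReal :=
    (Real.toNNReal_lt_toNNReal_iff (by positivity)).2 (by linarith)
  simp only [hgauss β σ hσ0, hgauss β' σ' hσ']
  rw [exists_charFun2_eq_iff, ofReal_smul_gaussianReal_le_iff _ _ (abs_nonneg κ) hv'.ne'
    (hv'.trans hv).ne', forall_mul_gaussianPDFReal_le_iff _ _ _ hv' hv,
    Real.coe_toNNReal _ (by positivity), Real.coe_toNNReal _ (by positivity),
    mul_div_mul_left _ _ two_ne_zero,
    show 2 * (2 * σ - 2 * σ') = 4 * (σ - σ') by ring]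
  rcases eq_or_ne κ 0 with rfl | hκ
  · simp only [abs_zero, true_or, iff_true]
    positivity
  · simp [hκ]
end

section
/- Let μ be a probability measure on X = ℝ × ℤ/2ℤ in the class Θ(X) with non-vanishing characteristic function, and suppose μ = μ₁ ∗ μ₂ with μ₁, μ₂ probability measures on X. Then the restriction of μ̂₁ to characters of the form (s,0) is of the form exp(−σ₁s² + iβ₁s) with σ₁ ≥ 0, i.e. the projection of μ₁ to ℝ is a (possibly degenerate) Gaussian distribution. -/
open MeasureTheory

/-- The class `Θ(ℝ × ℤ/2ℤ)` of distributions from the paper. -/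
def IsThetaClass (μ : Measure (ℝ × ZMod 2)) : Prop :=
  ∃ σ σ' β β' κ : ℝ,
    (∀ s : ℝ, charFun2 μ (s, 0) =
      Complex.exp (-(σ : ℂ) * s ^ 2 + (β : ℂ) * s * Complex.I)) ∧
    (∀ s : ℝ, charFun2 μ (s, 1) =
      (κ : ℂ) * Complex.exp (-(σ' : ℂ) * s ^ 2 + (β' : ℂ) * s * Complex.I)) ∧
    ((0 < σ' ∧ σ' < σ ∧ 0 < |κ| ∧
        |κ| ≤ Real.sqrt (σ' / σ) * Real.exp (-(β - β') ^ 2 / (4 * (σ - σ')))) ∨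
      (σ = σ' ∧ 0 ≤ σ ∧ β = β' ∧ |κ| ≤ 1))

open ProbabilityTheory Filter Topology

theorem Differentiable.exists_quadratic_of_norm_le {g : ℂ → ℂ} (hg : Differentiable ℂ g)
    {D : ℝ} (hD : ∀ z, ‖g z‖ ≤ D * (1 + ‖z‖ ^ 2)) :
    ∃ a b : ℂ, ∀ z, g z = g 0 + a * z + b * z ^ 2 := by
  have hzero : ∀ n : ℕ, 3 ≤ n → iteratedDeriv n g 0 = 0 := by
    intro n hn
    have hle : ∀ R : ℝ, 1 ≤ R → ‖iteratedDeriv n g 0‖ ≤ n.factorial * (2 * D) / R := by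
      intro R hR
      have hR0 : 0 < R := by linarith
      have hD0 : 0 ≤ D := by simpa using (norm_nonneg _).trans (hD 0)
      calc ‖iteratedDeriv n g 0‖
          ≤ n.factorial * (D * (1 + R ^ 2)) / R ^ n :=
            Complex.norm_iteratedDeriv_le_of_forall_mem_sphere_norm_le n hR0 hg.diffContOnCl
              fun z hz ↦ by simpa [mem_sphere_zero_iff_norm.1 hz] using hD z
        _ ≤ n.factorial * (D * (2 * R ^ 2)) / R ^ 3 := by
            gcongr
            nlinarith
        _ = n.factorial * (2 * D) / R := by field_simp
    have hlim : Tendsto (fun R : ℝ ↦ n.factorial * (2 * D) / R) atTop (𝓝 0) :=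
      tendsto_const_nhds.div_atTop tendsto_id
    have := ge_of_tendsto hlim ((eventually_ge_atTop 1).mono hle)
    exact norm_le_zero_iff.1 this
  refine ⟨iteratedDeriv 1 g 0, 2⁻¹ * iteratedDeriv 2 g 0, fun z ↦ ?_⟩
  rw [← Complex.taylorSeries_eq_of_entire' 0 z hg, tsum_eq_sum (s := Finset.range 3)]
  · simp [Finset.sum_range_succ]
  · intro n hn
    rw [hzero n (by simpa using hn)]
    simp

theorem Differentiable.exists_quadratic_of_re_le {g : ℂ → ℂ} (hg : Differentiable ℂ g)
    (h0 : g 0 = 0) {C : ℝ} (hC : 0 < C) (hre : ∀ z, (g z).re ≤ C * (1 + ‖z‖ ^ 2)) :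
    ∃ a b : ℂ, ∀ z, g z = a * z + b * z ^ 2 := by
  have hbound : ∀ z, ‖g z‖ ≤ 16 * C * (1 + ‖z‖ ^ 2) := by
    intro z
    have hz := norm_nonneg z
    have hR : 0 < 2 * ‖z‖ + 1 := by positivity
    have h := Complex.borelCaratheodory_zero (f := g) (z := z) (R := 2 * ‖z‖ + 1)
      (M := C * (1 + (2 * ‖z‖ + 1) ^ 2)) (by positivity) hg.differentiableOn
      (fun w hw ↦ by
        have hw' : ‖w‖ < 2 * ‖z‖ + 1 := mem_ball_zero_iff.1 hw
        refine (hre w).trans ?_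
        gcongr)
      hR (by simp; linarith) h0
    refine h.trans ?_
    rw [div_le_iff₀ (by linarith)]
    have : 2 * (1 + (2 * ‖z‖ + 1) ^ 2) ≤ 16 * (1 + ‖z‖ ^ 2) := by nlinarith [sq_nonneg (‖z‖ - 1)]
    calc 2 * (C * (1 + (2 * ‖z‖ + 1) ^ 2)) * ‖z‖
        = C * (2 * (1 + (2 * ‖z‖ + 1) ^ 2)) * ‖z‖ := by ring
      _ ≤ C * (16 * (1 + ‖z‖ ^ 2)) * (2 * ‖z‖ + 1 - ‖z‖) := by gcongr; linarith
      _ = _ := by ring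
  simpa [h0] using hg.exists_quadratic_of_norm_le hbound

theorem Differentiable.exists_exp_eq {f : ℂ → ℂ} (hf : Differentiable ℂ f) (hne : ∀ z, f z ≠ 0)
    (h0 : f 0 = 1) : ∃ g : ℂ → ℂ, Differentiable ℂ g ∧ g 0 = 0 ∧ ∀ z, f z = Complex.exp (g z) := by
  have hd : Differentiable ℂ (_root_.deriv f / f) := hf.deriv.div hf hne
  obtain ⟨g, hg0, hg⟩ := hd.isExactOn_univ.with_val_at 0 0
  have hg' : ∀ z, HasDerivAt g (_root_.deriv f z / f z) z := fun z ↦ hg z trivial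
  refine ⟨g, fun z ↦ (hg' z).differentiableAt, hg0, fun z ↦ ?_⟩
  have hh : ∀ w, HasDerivAt (fun z ↦ f z * Complex.exp (-g z)) 0 w := fun w ↦ by
    have hw := hne w
    refine ((hf w).hasDerivAt.mul (hg' w).neg.cexp).congr_deriv ?_
    simp only [Pi.neg_apply]
    field_simp
    ring
  have := is_const_of_deriv_eq_zero (fun w ↦ (hh w).differentiableAt) (fun w ↦ (hh w).deriv) z 0
  simp only [hg0, h0, neg_zero, Complex.exp_zero, mul_one, Complex.exp_neg] at this
  field_simp at this
  exact this

theorem Differentiable.exists_eq_exp_quadratic {f : ℂ → ℂ} (hf : Differentiable ℂ f)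
    (hne : ∀ z, f z ≠ 0) (h0 : f 0 = 1) {C : ℝ} (hC : 0 < C)
    (hle : ∀ z, ‖f z‖ ≤ Real.exp (C * (1 + ‖z‖ ^ 2))) :
    ∃ a b : ℂ, ∀ z, f z = Complex.exp (a * z + b * z ^ 2) := by
  obtain ⟨g, hg, hg0, hfg⟩ := hf.exists_exp_eq hne h0
  obtain ⟨a, b, hab⟩ := hg.exists_quadratic_of_re_le hg0 hC fun z ↦ by
    simpa [hfg, Complex.norm_exp] using hle z
  exact ⟨a, b, fun z ↦ by rw [hfg, hab]⟩

theorem exp_mul_integral_le_mgf {ν : Measure ℝ} [IsProbabilityMeasure ν]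
    (hν : ∀ t : ℝ, Integrable (fun x ↦ Real.exp (t * x)) ν) (t : ℝ) :
    Real.exp (t * ∫ x, x ∂ν) ≤ mgf id ν t := by
  have hint : Integrable (fun x : ℝ ↦ x) ν := by
    exact integrable_of_mem_interior_integrableExpSet (X := fun x ↦ x) (by simp [integrableExpSet, hν])
  set m := ∫ x, x ∂ν
  have hlin : Integrable (fun x ↦ t * (x - m)) ν :=
    (hint.sub (integrable_const m)).const_mul t
  have h1 : ∫ x, Real.exp (t * m) * (t * (x - m) + 1) ∂ν = Real.exp (t * m) := by
    rw [integral_const_mul, integral_add hlin (integrable_const 1), integral_const_mul,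
      integral_sub hint (integrable_const m)]
    simp [m]
  rw [← h1, mgf]
  refine integral_mono ((hlin.add (integrable_const 1)).const_mul _) (hν t) fun x ↦ ?_
  calc Real.exp (t * m) * (t * (x - m) + 1) ≤ Real.exp (t * m) * Real.exp (t * (x - m)) := by
        gcongr; exact Real.add_one_le_exp _
    _ = Real.exp (t * x) := by rw [← Real.exp_add]; ring_nf

theorem integrable_exp_mul_left_of_conv {ν₁ ν₂ : Measure ℝ} [IsProbabilityMeasure ν₁]
    [IsProbabilityMeasure ν₂] {t : ℝ}
    (h : Integrable (fun x ↦ Real.exp (t * x)) (ν₁.conv ν₂)) :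
    Integrable (fun x ↦ Real.exp (t * x)) ν₁ := by
  rw [Measure.conv_comm, integrable_conv_iff (by fun_prop)] at h
  obtain ⟨y, hy⟩ := h.1.exists
  simp only [mul_add, Real.exp_add] at hy
  exact (integrable_const_mul_iff (Real.exp_pos _).ne'.isUnit _).1 hy

theorem complexMGF_conv {ν₁ ν₂ : Measure ℝ} [IsProbabilityMeasure ν₁] [IsProbabilityMeasure ν₂]
    {z : ℂ} (h : Integrable (fun x ↦ Real.exp (z.re * x)) (ν₁.conv ν₂)) :
    complexMGF id (ν₁.conv ν₂) z = complexMGF id ν₁ z * complexMGF id ν₂ z := by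
  have hi : Integrable (fun x : ℝ ↦ Complex.exp (z * x)) (ν₁.conv ν₂) := by
    refine h.mono' (by fun_prop) (ae_of_all _ fun x ↦ ?_)
    simp [Complex.norm_exp]
  simp only [complexMGF, id]
  rw [integral_conv hi]
  simp only [Complex.ofReal_add, mul_add, Complex.exp_add, integral_const_mul, integral_mul_const]

/-- **Cramér's decomposition theorem**. -/
theorem eq_gaussianReal_of_conv_eq_gaussianReal {ν₁ ν₂ : Measure ℝ} [IsProbabilityMeasure ν₁]
    [IsProbabilityMeasure ν₂] {m : ℝ} {v : NNReal} (h : ν₁.conv ν₂ = gaussianReal m v) :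
    ∃ (m₁ : ℝ) (v₁ : NNReal), ν₁ = gaussianReal m₁ v₁ := by
  have hν (t : ℝ) : Integrable (fun x ↦ Real.exp (t * x)) (ν₁.conv ν₂) :=
    h ▸ integrable_exp_mul_gaussianReal t
  have hν₁ (t : ℝ) := integrable_exp_mul_left_of_conv (hν t)
  have hν₂ (t : ℝ) : Integrable (fun x ↦ Real.exp (t * x)) ν₂ :=
    integrable_exp_mul_left_of_conv (ν₂ := ν₁) (Measure.conv_comm ν₁ ν₂ ▸ hν t)
  have hset : integrableExpSet id ν₁ = Set.univ := by simp [integrableExpSet, hν₁]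
  have hmul (z : ℂ) : complexMGF id ν₁ z * complexMGF id ν₂ z
      = Complex.exp (z * m + v * z ^ 2 / 2) := by
    rw [← complexMGF_conv (hν _), h, complexMGF_id_gaussianReal]
  have hmulr (t : ℝ) : mgf id ν₁ t * mgf id ν₂ t = Real.exp (t * m + v * t ^ 2 / 2) := by
    have := hmul t
    rw [complexMGF_ofReal, complexMGF_ofReal] at this
    exact_mod_cast this
  have hdiff : Differentiable ℂ (complexMGF id ν₁) := by
    simpa [hset, differentiableOn_univ] using differentiableOn_complexMGF (X := id) (μ := ν₁)
  set m₂ := ∫ x, x ∂ν₂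
  have hle (t : ℝ) : mgf id ν₁ t ≤ Real.exp (t * (m - m₂) + v * t ^ 2 / 2) := by
    have h2 := exp_mul_integral_le_mgf hν₂ t
    rw [show t * (m - m₂) + v * t ^ 2 / 2 = t * m + v * t ^ 2 / 2 - t * m₂ by ring, Real.exp_sub,
      ← hmulr, le_div_iff₀ (Real.exp_pos _)]
    gcongr
    exact mgf_nonneg
  obtain ⟨a, b, hab⟩ := hdiff.exists_eq_exp_quadratic
    (fun z hz ↦ Complex.exp_ne_zero _ (by rw [← hmul z, hz, zero_mul])) (by simp [complexMGF])
    (C := |m - m₂| + v / 2 + 1) (by positivity) fun z ↦ by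
      refine norm_complexMGF_le_mgf.trans ((hle _).trans (Real.exp_le_exp.2 ?_))
      have h1 : |z.re| ^ 2 ≤ ‖z‖ ^ 2 := by gcongr; exact Complex.abs_re_le_norm z
      have h2 : z.re * (m - m₂) ≤ |m - m₂| * |z.re| := by
        rw [← abs_mul, mul_comm]; exact le_abs_self _
      have h3 : |z.re| ≤ 1 + ‖z‖ ^ 2 := by nlinarith [sq_nonneg (|z.re| - 1)]
      have h4 : |m - m₂| * |z.re| ≤ |m - m₂| * (1 + ‖z‖ ^ 2) := by gcongr
      have h5 : v * z.re ^ 2 / 2 ≤ (v / 2 : ℝ) * (1 + ‖z‖ ^ 2) := by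
        rw [mul_div_right_comm]; gcongr; rw [← sq_abs]; linarith
      nlinarith [sq_nonneg ‖z‖]
  have hmgf (t : ℝ) : mgf id ν₁ t = Real.exp (a.re * t + b.re * t ^ 2) := by
    have := congrArg norm (hab t)
    rw [complexMGF_ofReal, Complex.norm_real, Real.norm_of_nonneg mgf_nonneg,
      Complex.norm_exp] at this
    rw [this]
    simp [← Complex.ofReal_pow]
  have hb : 0 ≤ b.re := by
    have hj (t : ℝ) : t * ∫ x, x ∂ν₁ ≤ a.re * t + b.re * t ^ 2 := by
      have := exp_mul_integral_le_mgf hν₁ t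
      rwa [hmgf, Real.exp_le_exp] at this
    linarith [hj 1, hj (-1)]
  refine ⟨a.re, (2 * b.re).toNNReal, Measure.ext_of_complexMGF_id_eq (funext fun z ↦ ?_)⟩
  refine eqOn_complexMGF_of_mgf (funext fun t ↦ ?_) (by simp [hset])
  rw [hmgf, mgf_id_gaussianReal]
  rw [Real.coe_toNNReal _ (by positivity)]
  ring_nf

theorem charFun2_zero_right (μ : Measure (ℝ × ZMod 2)) (s : ℝ) :
    charFun2 μ (s, 0) = charFun (μ.map Prod.fst) s := by
  rw [charFun_apply_real, integral_map (by fun_prop) (by fun_prop)]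
  simp [charFun2, pairing]

theorem stmt_10 (μ μ₁ μ₂ : Measure (ℝ × ZMod 2)) [IsProbabilityMeasure μ]
    [IsProbabilityMeasure μ₁] [IsProbabilityMeasure μ₂]
    (hθ : IsThetaClass μ) (hnv : ∀ y, charFun2 μ y ≠ 0)
    (hconv : μ = μ₁.conv μ₂) :
    ∃ σ₁ β₁ : ℝ, 0 ≤ σ₁ ∧ ∀ s : ℝ, charFun2 μ₁ (s, 0) =
      Complex.exp (-(σ₁ : ℂ) * s ^ 2 + (β₁ : ℂ) * s * Complex.I) := by
  obtain ⟨σ, σ', β, β', κ, h0, -, hcases⟩ := hθ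
  have hσ : 0 ≤ σ := by
    rcases hcases with ⟨h1, h2, -⟩ | ⟨-, h, -⟩
    · exact (h1.trans h2).le
    · exact h
  have hprob (ρ : Measure (ℝ × ZMod 2)) [IsProbabilityMeasure ρ] :
      IsProbabilityMeasure (ρ.map Prod.fst) := Measure.isProbabilityMeasure_map (by fun_prop)
  have := hprob μ
  have := hprob μ₁
  have := hprob μ₂
  have hgauss : μ.map Prod.fst = gaussianReal β (2 * σ).toNNReal := by
    refine Measure.ext_of_charFun (funext fun s ↦ ?_)
    rw [← charFun2_zero_right, h0, charFun_gaussianReal, Real.coe_toNNReal _ (by positivity)]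
    push_cast
    ring_nf
  have hmap : (μ₁.map Prod.fst).conv (μ₂.map Prod.fst) = gaussianReal β (2 * σ).toNNReal := by
    rw [← hgauss, hconv]
    exact (Measure.map_conv_addMonoidHom (AddMonoidHom.fst ℝ (ZMod 2)) measurable_fst).symm
  obtain ⟨m₁, v₁, h₁⟩ := eq_gaussianReal_of_conv_eq_gaussianReal hmap
  refine ⟨v₁ / 2, m₁, by positivity, fun s ↦ ?_⟩
  rw [charFun2_zero_right, h₁, charFun_gaussianReal]
  push_cast
  ring_nf
end
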